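/- arXiv:2411.09366 — 9 statements merged into one kernel-verified Lean document; each statement's English description precedes it below -/
import Mathlib

section
/- Let A = (step, start, accept) be a DFA over alphabet Σ with finite state type σ, let w : ℕ → Σ be an infinite trace, and let ρ be the run of w in A. Then all but finitely many nonempty finite prefixes of w are accepted by A if and only if inf(ρ) ⊆ accept. -/
/-- The nonempty finite prefix `w(0)⋯w(n)` of an infinite trace `w`. -/
def tracePrefix {A : Type*} (w : ℕ → A) (n : ℕ) : List A :=
  (List.range (n + 1)).map w

/-- `infSet ρ`: the set of states occurring at infinitely many positions of `ρ`. -/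
def infSet {Q : Type*} (ρ : ℕ → Q) : Set Q :=
  {q | ∃ᶠ n in Filter.atTop, ρ n = q}

theorem eval_map_range_eq_run {A σ : Type*} (M : DFA A σ) (w : ℕ → A) (ρ : ℕ → σ)
    (h0 : ρ 0 = M.start) (hs : ∀ n : ℕ, ρ (n + 1) = M.step (ρ n) (w n)) (n : ℕ) :
    M.eval ((List.range n).map w) = ρ n := by
  induction n with
  | zero => simp [h0]
  | succ n ih => simp [List.range_succ, ih, hs]

theorem infSet_subset_iff_eventually_mem {Q : Type*} [Finite Q] (ρ : ℕ → Q) (S : Set Q) :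
    infSet ρ ⊆ S ↔ ∀ᶠ n in Filter.atTop, ρ n ∈ S := by
  constructor
  · intro h
    have key : ∀ᶠ n in Filter.atTop, ∀ q : Q, q ∉ S → ρ n ≠ q :=
      Filter.eventually_all.2 fun q => by
        by_cases hq : q ∈ S
        · simp [hq]
        · exact (Filter.not_frequently.1 fun hf => hq (h hf)).mono fun _ hn _ => hn
    filter_upwards [key] with n hn
    by_contra hq
    exact hn _ hq rfl
  · intro h q hq
    obtain ⟨n, rfl, hn⟩ := (Filter.Frequently.and_eventually hq h).exists
    exact hn

theorem stmt_5 {A σ : Type*} [Finite σ] (M : DFA A σ) (w : ℕ → A) (ρ : ℕ → σ)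
    (h0 : ρ 0 = M.start) (hs : ∀ n : ℕ, ρ (n + 1) = M.step (ρ n) (w n)) :
    (∀ᶠ n in Filter.atTop, tracePrefix w n ∈ M.accepts) ↔
      infSet ρ ⊆ M.accept := by
  have hacc (n : ℕ) : tracePrefix w n ∈ M.accepts ↔ ρ (n + 1) ∈ M.accept := by
    rw [DFA.mem_accepts, tracePrefix, eval_map_range_eq_run M w ρ h0 hs]
  simp only [hacc, infSet_subset_iff_eventually_mem]
  conv_rhs => rw [← Filter.map_add_atTop_eq_nat 1, Filter.eventually_map]
end

section
/- Let A = (step, start, accept) be a DFA over alphabet Σ with finite state type σ such that the start state has no incoming transitions, i.e., step q a ≠ start for all q and a. Let F′ = accept ∪ {start}, and define step′ by step′ q a = step q a if q ∈ F′ and step′ q a = q otherwise (every state outside F′ is a sink). Let w : ℕ → Σ be an infinite trace and let ρ′ be the run of w from start under step′. Then every nonempty finite prefix of w is accepted by A if and only if inf(ρ′) ∩ F′ ≠ ∅. -/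
/-- The states of a run on ever longer prefixes follow the transition function. -/
theorem DFA.eval_map_range_succ {A σ : Type*} (M : DFA A σ) (w : ℕ → A) (n : ℕ) :
    M.eval ((List.range (n + 1)).map w) = M.step (M.eval ((List.range n).map w)) (w n) := by
  simp [List.range_succ, DFA.eval_append_singleton]

/-- A sequence with values in a finite type visits some state infinitely often. -/
theorem infSet_nonempty {Q : Type*} [Finite Q] (ρ : ℕ → Q) : (infSet ρ).Nonempty := by
  obtain ⟨q, hq⟩ := Finite.exists_infinite_fiber ρ
  exact ⟨q, Nat.frequently_atTop_iff_infinite.2 (Set.infinite_coe_iff.1 hq)⟩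

theorem stmt_6 {A σ : Type*} [Finite σ] (M : DFA A σ)
    (hstart : ∀ (q : σ) (a : A), M.step q a ≠ M.start)
    (step' : σ → A → σ)
    (hin : ∀ (q : σ) (a : A), q ∈ M.accept ∪ {M.start} → step' q a = M.step q a)
    (hout : ∀ (q : σ) (a : A), q ∉ M.accept ∪ {M.start} → step' q a = q)
    (w : ℕ → A) (ρ' : ℕ → σ)
    (h0 : ρ' 0 = M.start) (hs : ∀ n : ℕ, ρ' (n + 1) = step' (ρ' n) (w n)) :
    (∀ n : ℕ, tracePrefix w n ∈ M.accepts) ↔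
      (infSet ρ' ∩ (M.accept ∪ {M.start})).Nonempty := by
  have run_eq : (∀ n, M.eval ((List.range n).map w) ∈ M.accept ∪ {M.start} ∨
      ρ' n ∈ M.accept ∪ {M.start}) → ∀ n, ρ' n = M.eval ((List.range n).map w) := by
    intro h n
    induction n with
    | zero => simpa using h0
    | succ n ih =>
      have hn : ρ' n ∈ M.accept ∪ {M.start} := (h n).elim (fun h' => ih ▸ h') id
      rw [hs, hin _ _ hn, ih, DFA.eval_map_range_succ]
  constructor
  · intro h
    have hF : ∀ n, M.eval ((List.range n).map w) ∈ M.accept ∪ {M.start} := by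
      rintro (_ | n)
      · simp
      · exact Or.inl (h n)
    obtain ⟨q, hq⟩ := infSet_nonempty ρ'
    obtain ⟨n, rfl⟩ := Filter.Frequently.exists hq
    exact ⟨_, hq, run_eq (fun n => Or.inl (hF n)) n ▸ hF n⟩
  · rintro ⟨q, hq, hqF⟩ n
    have hF : ∀ n, ρ' n ∈ M.accept ∪ {M.start} := by
      intro n
      by_contra hn
      have sink : ∀ m, n ≤ m → ρ' m = ρ' n := by
        intro m hm
        induction m, hm using Nat.le_induction with
        | base => rfl
        | succ m _ ih => rw [hs, ih, hout _ _ hn]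
      obtain ⟨m, hm, rfl⟩ := Filter.frequently_atTop.1 hq n
      exact hn (sink m hm ▸ hqF)
    have hacc := hF (n + 1)
    rw [run_eq (fun n => Or.inr (hF n)), DFA.eval_map_range_succ] at hacc
    rw [DFA.mem_accepts, tracePrefix, DFA.eval_map_range_succ]
    exact hacc.resolve_right (hstart _ _)
end

section
/- Let A = (step, start, accept) be a DFA over alphabet Σ with state type σ such that the start state has no incoming transitions, i.e., step q a ≠ start for all q and a. Let F′ = accept \ {start}, and define step′ by step′ q a = q if q ∈ F′ and step′ q a = step q a otherwise (every state in F′ is a sink). Let w : ℕ → Σ be an infinite trace and let ρ′ be the run of w from start under step′. Then some nonempty finite prefix of w is accepted by A if and only if inf(ρ′) ∩ F′ ≠ ∅. -/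
/-- Making the states of `F` sinks does not change a run before it first visits `F`. -/
theorem sink_run_eq_of_forall_notMem {A σ : Type*} {step step' : σ → A → σ} {F : Set σ}
    (hout : ∀ q a, q ∉ F → step' q a = step q a) {w : ℕ → A} {ρ ρ' : ℕ → σ}
    (h0 : ρ' 0 = ρ 0) (hρ : ∀ n, ρ (n + 1) = step (ρ n) (w n))
    (hρ' : ∀ n, ρ' (n + 1) = step' (ρ' n) (w n)) {n : ℕ} (hn : ∀ k < n, ρ k ∉ F) :
    ρ' n = ρ n := by
  induction n with
  | zero => exact h0
  | succ n ih =>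
    rw [hρ', hρ, ih fun k hk => hn k (by omega), hout _ _ (hn n (by omega))]

/-- A run that reaches a sink stays there. -/
theorem run_eq_of_sink {A σ : Type*} {step' : σ → A → σ} {w : ℕ → A} {ρ' : ℕ → σ}
    (hρ' : ∀ n, ρ' (n + 1) = step' (ρ' n) (w n)) {m : ℕ}
    (hm : ∀ a, step' (ρ' m) a = ρ' m) {n : ℕ} (hn : m ≤ n) : ρ' n = ρ' m := by
  induction n, hn using Nat.le_induction with
  | base => rfl
  | succ n _ ih => rw [hρ', ih, hm]


theorem stmt_7 {A σ : Type*} (M : DFA A σ)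
    (hstart : ∀ (q : σ) (a : A), M.step q a ≠ M.start)
    (step' : σ → A → σ)
    (hin : ∀ (q : σ) (a : A), q ∈ M.accept \ {M.start} → step' q a = q)
    (hout : ∀ (q : σ) (a : A), q ∉ M.accept \ {M.start} → step' q a = M.step q a)
    (w : ℕ → A) (ρ' : ℕ → σ)
    (h0 : ρ' 0 = M.start) (hs : ∀ n : ℕ, ρ' (n + 1) = step' (ρ' n) (w n)) :
    (∃ n : ℕ, tracePrefix w n ∈ M.accepts) ↔
      (infSet ρ' ∩ (M.accept \ {M.start})).Nonempty := by
  classical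
  set F := M.accept \ {M.start}
  let ρ : ℕ → σ := fun n => M.eval ((List.range n).map w)
  have hρ0 : ρ 0 = M.start := rfl
  have hρ (n : ℕ) : ρ (n + 1) = M.step (ρ n) (w n) := by
    simp [ρ, List.range_succ, DFA.eval_append_singleton]
  have h_eq {n : ℕ} (hn : ∀ k < n, ρ k ∉ F) : ρ' n = ρ n :=
    sink_run_eq_of_forall_notMem hout (h0.trans hρ0.symm) hρ hs hn
  constructor
  · rintro ⟨n, hn⟩
    have hex : ∃ m, ρ m ∈ F :=
      ⟨n + 1, hn, by rw [hρ]; exact hstart _ _⟩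
    have hm : ρ' (Nat.find hex) ∈ F := by
      rw [h_eq fun k hk => Nat.find_min hex hk]
      exact Nat.find_spec hex
    refine ⟨ρ' (Nat.find hex), Filter.Eventually.frequently ?_, hm⟩
    filter_upwards [Filter.eventually_ge_atTop (Nat.find hex)] with n hn
    exact run_eq_of_sink hs (fun a => hin _ a hm) hn
  · rintro ⟨q, hq, hqF⟩
    obtain ⟨n, rfl⟩ := Filter.Frequently.exists hq
    obtain ⟨k, hk⟩ : ∃ k, ρ k ∈ F := by
      by_contra! h
      exact h n (h_eq (fun k _ => h k) ▸ hqF)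
    cases k with
    | zero => exact absurd hρ0 hk.2
    | succ k => exact ⟨k, hk.1⟩
end

section
/- Let Q₁ and Q₂ be finite types, ρ₁ : ℕ → Q₁ and ρ₂ : ℕ → Q₂ sequences, and let (lab₁, B₁) be an EL condition over Q₁ with label type Γ₁ and (lab₂, B₂) an EL condition over Q₂ with label type Γ₂. Over Q₁ × Q₂ with label type Γ₁ ⊕ Γ₂ define lab(p, q) = Sum.inl '' (lab₁ p) ∪ Sum.inr '' (lab₂ q), and for X ⊆ Γ₁ ⊕ Γ₂ define B∨(X) = B₁(Sum.inl ⁻¹' X) ∨ B₂(Sum.inr ⁻¹' X) and B∧(X) = B₁(Sum.inl ⁻¹' X) ∧ B₂(Sum.inr ⁻¹' X). Let ρ n = (ρ₁ n, ρ₂ n). Then ρ satisfies the EL condition (lab, B∨) if and only if ρ₁ satisfies (lab₁, B₁) or ρ₂ satisfies (lab₂, B₂); and ρ satisfies (lab, B∧) if and only if ρ₁ satisfies (lab₁, B₁) and ρ₂ satisfies (lab₂, B₂). -/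
/-- A sequence `ρ` satisfies the Emerson–Lei condition `(lab, B)` iff `B` holds of the
union of the label sets of the states occurring infinitely often in `ρ`. -/
def SatEL {Q Γ : Type*} (lab : Q → Set Γ) (B : Set Γ → Prop) (ρ : ℕ → Q) : Prop :=
  B (⋃ q ∈ infSet ρ, lab q)

/-- For a sequence over a finite type, mapping commutes with taking the set of states
occurring infinitely often. -/
theorem infSet_comp {Q R : Type*} [Finite Q] (f : Q → R) (ρ : ℕ → Q) :
    infSet (fun n => f (ρ n)) = f '' infSet ρ := by
  ext r
  constructor
  · intro h
    by_contra hr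
    have hev : ∀ q, ∀ᶠ n in Filter.atTop, f q = r → ρ n ≠ q := by
      intro q
      by_cases hq : f q = r
      · have hn : ¬ ∃ᶠ n in Filter.atTop, ρ n = q := fun h' => hr ⟨q, h', hq⟩
        exact (Filter.not_frequently.mp hn).mono fun n hn _ => hn
      · exact Filter.Eventually.of_forall fun n h' => absurd h' hq
    exact h ((Filter.eventually_all.mpr hev).mono fun n hn hf => hn (ρ n) hf rfl)
  · rintro ⟨q, hq, rfl⟩
    exact Filter.Frequently.mono hq fun n hn => congrArg f hn

/-- The labels seen infinitely often along the image of a sequence over a finite type. -/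
theorem biUnion_infSet_comp {Q R Γ : Type*} [Finite Q] (f : Q → R) (ρ : ℕ → Q)
    (lab : R → Set Γ) :
    ⋃ r ∈ infSet (fun n => f (ρ n)), lab r = ⋃ q ∈ infSet ρ, lab (f q) := by
  rw [infSet_comp, Set.biUnion_image]

theorem stmt_8 {Q₁ Q₂ Γ₁ Γ₂ : Type*} [Finite Q₁] [Finite Q₂]
    (ρ₁ : ℕ → Q₁) (ρ₂ : ℕ → Q₂)
    (lab₁ : Q₁ → Set Γ₁) (B₁ : Set Γ₁ → Prop)
    (lab₂ : Q₂ → Set Γ₂) (B₂ : Set Γ₂ → Prop) :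
    (SatEL (fun pq : Q₁ × Q₂ => Sum.inl '' lab₁ pq.1 ∪ Sum.inr '' lab₂ pq.2)
        (fun X : Set (Γ₁ ⊕ Γ₂) => B₁ (Sum.inl ⁻¹' X) ∨ B₂ (Sum.inr ⁻¹' X))
        (fun n => (ρ₁ n, ρ₂ n)) ↔
      SatEL lab₁ B₁ ρ₁ ∨ SatEL lab₂ B₂ ρ₂) ∧
    (SatEL (fun pq : Q₁ × Q₂ => Sum.inl '' lab₁ pq.1 ∪ Sum.inr '' lab₂ pq.2)
        (fun X : Set (Γ₁ ⊕ Γ₂) => B₁ (Sum.inl ⁻¹' X) ∧ B₂ (Sum.inr ⁻¹' X))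
        (fun n => (ρ₁ n, ρ₂ n)) ↔
      SatEL lab₁ B₁ ρ₁ ∧ SatEL lab₂ B₂ ρ₂) := by
  have hl : Sum.inl ⁻¹' (⋃ pq ∈ infSet (fun n => (ρ₁ n, ρ₂ n)),
      (Sum.inl '' lab₁ pq.1 ∪ Sum.inr '' lab₂ pq.2)) = ⋃ p ∈ infSet ρ₁, lab₁ p := by
    rw [biUnion_infSet_comp Prod.fst (fun n => (ρ₁ n, ρ₂ n)) lab₁]
    ext x
    simp
  have hr : Sum.inr ⁻¹' (⋃ pq ∈ infSet (fun n => (ρ₁ n, ρ₂ n)),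
      (Sum.inl '' lab₁ pq.1 ∪ Sum.inr '' lab₂ pq.2)) = ⋃ q ∈ infSet ρ₂, lab₂ q := by
    rw [biUnion_infSet_comp Prod.snd (fun n => (ρ₁ n, ρ₂ n)) lab₂]
    ext x
    simp
  simp only [SatEL, hl, hr, and_self]
end

section
/- Let Γ be a finite set with |Γ| = k ≥ 1, let X : ℕ → Set Γ be a sequence of label sets, and let π : ℕ → (Fin k ≃ Γ) be a sequence of permutations of Γ with π(n+1) = π(n) ⟪ X(n) for all n. If x ∈ X(l) and y ∉ X(j) for every j ≥ l, then for every j > l the position of x in π(j) is smaller than the position of y in π(j). -/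
/-- `IsPushLeft π X π'` says that `π' = π ⟪ X`: the permutation `π'` is obtained
from `π` by pushing the elements of `X` all the way to the left (keeping the relative
order of elements inside `X`, and of elements outside `X`). -/
def IsPushLeft {Γ : Type*} {k : ℕ} (π : Fin k ≃ Γ) (X : Set Γ) (π' : Fin k ≃ Γ) : Prop :=
  (∀ x ∈ X, ∀ y ∉ X, π'.symm x < π'.symm y) ∧
  (∀ x y : Γ, ((x ∈ X ∧ y ∈ X) ∨ (x ∉ X ∧ y ∉ X)) →
    (π'.symm x < π'.symm y ↔ π.symm x < π.symm y))

theorem stmt_10 {Γ : Type*} [Fintype Γ] {k : ℕ} (hk : Fintype.card Γ = k) (hk1 : 1 ≤ k)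
    (X : ℕ → Set Γ) (π : ℕ → (Fin k ≃ Γ))
    (hpush : ∀ n : ℕ, IsPushLeft (π n) (X n) (π (n + 1)))
    (x y : Γ) (l : ℕ)
    (hx : x ∈ X l) (hy : ∀ j ≥ l, y ∉ X j) :
    ∀ j > l, (π j).symm x < (π j).symm y := by
  intro j hj
  induction j, hj using Nat.le_induction with
  | base => exact (hpush l).1 x hx y (hy l le_rfl)
  | succ n hn ih =>
    have hyn : y ∉ X n := hy n (Nat.le_of_succ_le hn)
    by_cases hxn : x ∈ X n
    · exact (hpush n).1 x hxn y hyn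
    · exact ((hpush n).2 x y (Or.inr ⟨hxn, hyn⟩)).2 ih
end

section
/- In the permutation-and-pointer construction along a run (see context), there exists an index i such that for every j ≥ i, the permutation π(j) displays I and the pointer satisfies h(j) < |I|. -/
/-- `IsMaxPos π X h` says that `h = maxPos(X, π)`: `h` is the largest position in `π`
of an element of `X`. -/
def IsMaxPos {Γ : Type*} {k : ℕ} (π : Fin k ≃ Γ) (X : Set Γ) (h : Fin k) : Prop :=
  π h ∈ X ∧ ∀ i : Fin k, π i ∈ X → i ≤ h

/-- `π` displays the nonempty set `X` iff `X` is exactly the set of labels at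
positions `0,…,|X|−1` of `π`. -/
def Displays {Γ : Type*} {k : ℕ} (π : Fin k ≃ Γ) (X : Set Γ) : Prop :=
  ∀ a : Γ, a ∈ X ↔ ((π.symm a : ℕ) < X.ncard)

/-- `(π, h)` separates `X` iff `π` displays `X` and `h = |X| − 1`. -/
def Separates {Γ : Type*} {k : ℕ} (π : Fin k ≃ Γ) (h : Fin k) (X : Set Γ) : Prop :=
  Displays π X ∧ (h : ℕ) = X.ncard - 1

/-- A permutation displays `X` as soon as all elements of `X` precede all other labels. -/
theorem displays_of_forall_lt {Γ : Type*} {k : ℕ} (π : Fin k ≃ Γ) (X : Set Γ)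
    (hX : ∀ x ∈ X, ∀ y ∉ X, π.symm x < π.symm y) : Displays π X := by
  have hcard : (π.symm '' X).ncard = X.ncard := Set.ncard_image_of_injective X π.symm.injective
  intro a
  rw [← hcard]
  constructor
  · intro ha
    have hsub : Set.Iic (π.symm a) ⊆ π.symm '' X := by
      intro i hi
      refine ⟨π i, ?_, π.symm_apply_apply i⟩
      by_contra hn
      have hlt := hX a ha _ hn
      rw [π.symm_apply_apply] at hlt
      exact absurd hlt (not_lt.mpr hi)
    have hle := Set.ncard_le_ncard hsub (Set.toFinite _)
    rw [← Finset.coe_Iic, Set.ncard_coe_finset, Fin.card_Iic] at hle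
    omega
  · intro hlt
    by_contra ha
    have hsub : π.symm '' X ⊆ Set.Iio (π.symm a) := by
      rintro _ ⟨x, hx, rfl⟩
      exact hX x hx a ha
    have hle := Set.ncard_le_ncard hsub (Set.toFinite _)
    rw [← Finset.coe_Iio, Set.ncard_coe_finset, Fin.card_Iio] at hle
    omega

/-- Pushing a set that avoids `y` to the left keeps every label preceding `y` before `y`. -/
theorem IsPushLeft.symm_lt_symm {Γ : Type*} {k : ℕ} {π π' : Fin k ≃ Γ} {X : Set Γ}
    (hπ : IsPushLeft π X π') {x y : Γ} (hy : y ∉ X) (hxy : π.symm x < π.symm y) :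
    π'.symm x < π'.symm y := by
  by_cases hx : x ∈ X
  · exact hπ.1 x hx y hy
  · exact (hπ.2 x y (Or.inr ⟨hx, hy⟩)).2 hxy

theorem stmt_11 {Q Γ : Type*} [Finite Q] [Fintype Γ] {k : ℕ}
    (hcard : Fintype.card Γ = k) (hk : 1 ≤ k)
    (lab : Q → Set Γ) (hlab : ∀ q : Q, (lab q).Nonempty)
    (ρ : ℕ → Q)
    (π : ℕ → (Fin k ≃ Γ)) (h : ℕ → Fin k)
    (hπ : ∀ n : ℕ, IsPushLeft (π n) (lab (ρ n)) (π (n + 1)))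
    (hh0 : (h 0 : ℕ) = 0)
    (hh : ∀ n : ℕ, IsMaxPos (π n) (lab (ρ n)) (h (n + 1))) :
    ∃ i : ℕ, ∀ j ≥ i,
      Displays (π j) {a : Γ | ∃ᶠ n in Filter.atTop, a ∈ lab (ρ n)} ∧
      (h j : ℕ) < ({a : Γ | ∃ᶠ n in Filter.atTop, a ∈ lab (ρ n)}).ncard := by
  set I : Set Γ := {a : Γ | ∃ᶠ n in Filter.atTop, a ∈ lab (ρ n)}
  have hsub : ∀ᶠ n in Filter.atTop, ∀ a : Γ, a ∉ I → a ∉ lab (ρ n) := by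
    rw [Filter.eventually_all]
    intro a
    by_cases ha : a ∈ I
    · exact Filter.Eventually.of_forall fun n hn => absurd ha hn
    · exact (Filter.not_frequently.mp ha).mono fun n hn _ => hn
  obtain ⟨N, hN⟩ := Filter.eventually_atTop.mp hsub
  have hlt : ∀ᶠ n in Filter.atTop, ∀ x : Γ, x ∈ I → ∀ y ∉ I, (π n).symm x < (π n).symm y := by
    rw [Filter.eventually_all]
    intro x
    by_cases hx : x ∈ I
    · obtain ⟨m, hm, hxm⟩ := Filter.frequently_atTop.mp hx N
      refine Filter.eventually_atTop.mpr ⟨m + 1, fun n hn _ y hy => ?_⟩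
      induction n, hn using Nat.le_induction with
      | base => exact (hπ m).1 x hxm y (hN m hm y hy)
      | succ n hn ih => exact (hπ n).symm_lt_symm (hN n (by omega) y hy) ih
    · exact Filter.Eventually.of_forall fun n hn => absurd hn hx
  obtain ⟨M, hM⟩ := Filter.eventually_atTop.mp hlt
  have hdisp : ∀ n ≥ M, Displays (π n) I := fun n hn => displays_of_forall_lt _ _ (hM n hn)
  refine ⟨max N M + 1, fun j hj => ⟨hdisp j (by omega), ?_⟩⟩
  obtain ⟨n, rfl⟩ : ∃ n, j = n + 1 := ⟨j - 1, by omega⟩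
  have hmem : π n (h (n + 1)) ∈ I := by
    by_contra hn
    exact hN n (by omega) _ hn (hh n).1
  simpa using (hdisp n (by omega) _).1 hmem
end

section
/- In the permutation-and-pointer construction along a run (see context), for every n there exists m > n such that the pair (π(m), h(m)) separates I. -/
/-- A label occurring infinitely often is eventually before every label that does not. -/
theorem eventually_symm_lt_symm {Γ : Type*} {k : ℕ} {L : ℕ → Set Γ} {π : ℕ → (Fin k ≃ Γ)}
    (hπ : ∀ n, IsPushLeft (π n) (L n) (π (n + 1))) {x y : Γ}
    (hx : ∃ᶠ n in Filter.atTop, x ∈ L n) (hy : ¬ ∃ᶠ n in Filter.atTop, y ∈ L n) :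
    ∀ᶠ n in Filter.atTop, (π n).symm x < (π n).symm y := by
  obtain ⟨N, hN⟩ := Filter.eventually_atTop.1 (Filter.not_frequently.1 hy)
  obtain ⟨n, hn, hxn⟩ := Filter.frequently_atTop.1 hx N
  refine Filter.eventually_atTop.2 ⟨n + 1, fun m hm => ?_⟩
  induction m, hm using Nat.le_induction with
  | base => exact (hπ n).1 x hxn y (hN n hn)
  | succ m hm ih =>
    have hym : y ∉ L m := hN m (by omega)
    by_cases hxm : x ∈ L m
    · exact (hπ m).1 x hxm y hym
    · exact ((hπ m).2 x y (Or.inr ⟨hxm, hym⟩)).2 ih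

/-- Until it is pushed itself, a label stays behind all labels it was behind. -/
theorem IsPushLeft.symm_le_symm {Γ : Type*} {k : ℕ} {X : Set Γ} {π π' : Fin k ≃ Γ}
    (hπ : IsPushLeft π X π') {x a : Γ} (ha : a ∉ X) (hxa : π.symm x ≤ π.symm a) :
    π'.symm x ≤ π'.symm a := by
  rcases hxa.eq_or_lt with heq | hlt
  · rw [π.symm.injective heq]
  · by_cases hx : x ∈ X
    · exact (hπ.1 x hx a ha).le
    · exact ((hπ.2 x a (Or.inr ⟨hx, ha⟩)).2 hlt).le

theorem stmt_12 {Q Γ : Type*} [Finite Q] [Fintype Γ] {k : ℕ}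
    (hcard : Fintype.card Γ = k) (hk : 1 ≤ k)
    (lab : Q → Set Γ) (hlab : ∀ q : Q, (lab q).Nonempty)
    (ρ : ℕ → Q)
    (π : ℕ → (Fin k ≃ Γ)) (h : ℕ → Fin k)
    (hπ : ∀ n : ℕ, IsPushLeft (π n) (lab (ρ n)) (π (n + 1)))
    (hh0 : (h 0 : ℕ) = 0)
    (hh : ∀ n : ℕ, IsMaxPos (π n) (lab (ρ n)) (h (n + 1))) :
    ∀ n : ℕ, ∃ m > n,
      Separates (π m) (h m) {a : Γ | ∃ᶠ n' in Filter.atTop, a ∈ lab (ρ n')} := by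
  intro n
  set I : Set Γ := {a : Γ | ∃ᶠ n' in Filter.atTop, a ∈ lab (ρ n')} with hI
  have hsub : ∀ᶠ m in Filter.atTop, ∀ a, a ∈ lab (ρ m) → a ∈ I := by
    refine Filter.eventually_all.2 fun a => ?_
    by_cases ha : a ∈ I
    · exact Filter.Eventually.of_forall fun _ _ => ha
    · exact (Filter.not_frequently.1 ha).mono fun m hm h' => absurd h' hm
  have hdisp : ∀ᶠ m in Filter.atTop, Displays (π m) I := by
    have hlt : ∀ᶠ m in Filter.atTop,
        ∀ x y, x ∈ I → y ∉ I → (π m).symm x < (π m).symm y := by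
      refine Filter.eventually_all.2 fun x => Filter.eventually_all.2 fun y => ?_
      by_cases hxy : x ∈ I ∧ y ∉ I
      · exact (eventually_symm_lt_symm hπ hxy.1 hxy.2).mono fun _ hm _ _ => hm
      · exact Filter.Eventually.of_forall fun _ hx hy => absurd ⟨hx, hy⟩ hxy
    exact hlt.mono fun m hm => displays_of_forall_lt _ _ fun x hx y hy => hm x y hx hy
  obtain ⟨M, hM⟩ := Filter.eventually_atTop.1 (hsub.and hdisp)
  obtain ⟨N, hNM, hNn⟩ : ∃ N, M ≤ N ∧ n ≤ N := ⟨max M n, le_max_left _ _, le_max_right _ _⟩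
  have hne : I.Nonempty := (hlab (ρ N)).mono (hM N hNM).1
  obtain ⟨a, haI, hamax⟩ := Set.exists_max_image I (π N).symm (Set.toFinite I) hne
  have hex : ∃ m, N ≤ m ∧ a ∈ lab (ρ m) := Filter.frequently_atTop.1 haI N
  classical
  obtain ⟨hm, ham⟩ := Nat.find_spec hex
  have hmin := fun j => Nat.find_min (H := hex) (m := j)
  set m := Nat.find hex
  have hlast : ∀ j, N ≤ j → j ≤ m → ∀ x ∈ I, (π j).symm x ≤ (π j).symm a := by
    intro j hj
    induction j, hj using Nat.le_induction with
    | base => exact fun _ => hamax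
    | succ j hj ih =>
      intro hjm x hx
      exact (hπ j).symm_le_symm (fun haj => hmin j (by omega) ⟨hj, haj⟩) (ih (by omega) x hx)
  refine ⟨m + 1, by omega, (hM (m + 1) (by omega)).2, ?_⟩
  have hMm := hM m (by omega)
  have hpos : ((π m).symm a : ℕ) < I.ncard := (hMm.2 a).1 haI
  have hcardI : I.ncard ≤ k := by
    rw [← hcard, ← Nat.card_eq_fintype_card]
    exact Set.ncard_le_card I
  have hle : I.ncard - 1 ≤ ((π m).symm a : ℕ) := by
    have hlt : I.ncard - 1 < k := by omega
    have hb : π m ⟨I.ncard - 1, hlt⟩ ∈ I := by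
      refine (hMm.2 _).2 ?_
      rw [Equiv.symm_apply_apply]
      change I.ncard - 1 < I.ncard
      omega
    simpa [Fin.le_def] using hlast m hm le_rfl _ hb
  have hge : (π m).symm a ≤ h (m + 1) := (hh m).2 _ (by simpa using ham)
  have hup : h (m + 1) ≤ (π m).symm a := by
    simpa using hlast m hm le_rfl _ (hMm.1 _ (hh m).1)
  rw [le_antisymm hup hge]
  omega
end

section
/- Let Q be a finite type, Σ an alphabet, δ : Q → Σ → Q a deterministic transition function, q₀ : Q, and (lab, B) an EL condition over Q with finite label set Γ, |Γ| = k ≥ 1, such that lab q is nonempty for every q. Define a deterministic parity automaton with state type Q × (Fin k ≃ Γ) × Fin k, transition δ′((q, π, h), a) = (δ q a, π ⟪ lab q, maxPos(lab q, π)), initial state (q₀, π₀, 0) for an arbitrary permutation π₀, and coloring c(q, π, h) = 2(h+1) if B(X) holds and c(q, π, h) = 2(h+1) − 1 otherwise, where X is the set of labels at positions 0,…,h of π. Then for every infinite trace w : ℕ → Σ, the run of w from q₀ under δ satisfies the EL condition (lab, B) if and only if the run of w from (q₀, π₀, 0) under δ′ satisfies the parity condition. Moreover all colors lie in {1,…,2k}.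 -/
/-- The run of the infinite trace `w` from the state `q₀` under the transition
function `δ`. -/
def run {Q A : Type*} (δ : Q → A → Q) (q₀ : Q) (w : ℕ → A) : ℕ → Q
  | 0 => q₀
  | n + 1 => δ (run δ q₀ w n) (w n)

/-- A sequence `ϱ` satisfies the parity condition given by the coloring `c` iff the
largest color of a state occurring infinitely often in `ϱ` is even. -/
def SatParity {S : Type*} (c : S → ℕ) (ϱ : ℕ → S) : Prop :=
  ∃ m : ℕ, Even m ∧ (∃ s ∈ infSet ϱ, c s = m) ∧ ∀ s ∈ infSet ϱ, c s ≤ m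

open Filter

section PushLeft

variable {Γ : Type*} {k : ℕ}

/-- `labelPrefix π h` is the set of labels at positions `0, …, h` of `π`. -/
def labelPrefix (π : Fin k ≃ Γ) (h : Fin k) : Set Γ :=
  {a | (π.symm a : ℕ) ≤ (h : ℕ)}

theorem ncard_labelPrefix (π : Fin k ≃ Γ) (h : Fin k) :
    (labelPrefix π h).ncard = (h : ℕ) + 1 := by
  have himage : labelPrefix π h = π '' (Finset.Iic h : Finset (Fin k)) := by
    ext a
    simp [labelPrefix]
  rw [himage, Set.ncard_image_of_injective _ π.injective, Set.ncard_coe_finset, Fin.card_Iic]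

/-- A set preceding its complement in `π` and having `h + 1` elements is a prefix of `π`. -/
theorem labelPrefix_eq_of_forall_lt [Finite Γ] {π : Fin k ≃ Γ} {h : Fin k} {S : Set Γ}
    (hlt : ∀ x ∈ S, ∀ y ∉ S, π.symm x < π.symm y) (hS : S.ncard = (h : ℕ) + 1) :
    labelPrefix π h = S := by
  have hcard := (ncard_labelPrefix π h).trans hS.symm
  by_cases hsub : S ⊆ labelPrefix π h
  · exact (Set.eq_of_subset_of_ncard_le hsub hcard.le (Set.toFinite _)).symm
  · obtain ⟨x, hxS, hx⟩ := Set.not_subset.1 hsub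
    refine Set.eq_of_subset_of_ncard_le (fun a ha => ?_) hcard.ge (Set.toFinite _)
    by_contra haS
    have := hlt x hxS a haS
    simp only [labelPrefix, Set.mem_ofPred_eq, not_le] at hx ha
    omega

/-- Pushing `X` to the left does not change the prefix that ends at the maximal position
of `X`. -/
theorem IsPushLeft.labelPrefix_eq [Finite Γ] {π π' : Fin k ≃ Γ} {X : Set Γ} {h : Fin k}
    (hpush : IsPushLeft π X π') (hmax : IsMaxPos π X h) :
    labelPrefix π' h = labelPrefix π h := by
  refine labelPrefix_eq_of_forall_lt (fun x hx y hy => ?_) (ncard_labelPrefix π h)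
  have hyX : y ∉ X := fun hyX => hy (hmax.2 (π.symm y) (by simpa using hyX))
  by_cases hxX : x ∈ X
  · exact hpush.1 x hxX y hyX
  · refine (hpush.2 x y (Or.inr ⟨hxX, hyX⟩)).2 ?_
    simp only [labelPrefix, Set.mem_ofPred_eq, not_le] at hx hy
    omega

/-- An element outside the pushed set keeps all its predecessors. -/
theorem IsPushLeft.lt_of_lt {π π' : Fin k ≃ Γ} {X : Set Γ} (hpush : IsPushLeft π X π')
    {x y : Γ} (hy : y ∉ X) (hlt : π.symm x < π.symm y) : π'.symm x < π'.symm y := by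
  by_cases hx : x ∈ X
  · exact hpush.1 x hx y hy
  · exact (hpush.2 x y (Or.inr ⟨hx, hy⟩)).2 hlt

variable {π : ℕ → Fin k ≃ Γ} {L : ℕ → Set Γ} {h : ℕ → Fin k} {F : Set Γ}

theorem eventually_forall_lt_of_isPushLeft [Finite Γ]
    (hpush : ∀ n, IsPushLeft (π n) (L n) (π (n + 1)))
    (hsub : ∀ᶠ n in atTop, L n ⊆ F) (hfreq : ∀ a ∈ F, ∃ᶠ n in atTop, a ∈ L n) :
    ∀ᶠ n in atTop, ∀ x ∈ F, ∀ y ∉ F, (π n).symm x < (π n).symm y := by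
  simp only [eventually_all]
  intro x hx y hy
  obtain ⟨N, hN⟩ := eventually_atTop.1 hsub
  obtain ⟨n, hn, hxn⟩ := frequently_atTop.1 (hfreq x hx) N
  refine eventually_atTop.2 ⟨n + 1, fun m hm => ?_⟩
  induction m, hm using Nat.le_induction with
  | base => exact (hpush n).1 x hxn y fun hyn => hy (hN n hn hyn)
  | succ m hm ih => exact (hpush m).lt_of_lt (fun hym => hy (hN m (by omega) hym)) ih

theorem eventually_labelPrefix_subset [Finite Γ]
    (hpush : ∀ n, IsPushLeft (π n) (L n) (π (n + 1)))
    (hmax : ∀ n, IsMaxPos (π n) (L n) (h (n + 1)))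
    (hsub : ∀ᶠ n in atTop, L n ⊆ F) (hfreq : ∀ a ∈ F, ∃ᶠ n in atTop, a ∈ L n) :
    ∀ᶠ n in atTop, labelPrefix (π n) (h n) ⊆ F := by
  have hev : ∀ᶠ n in atTop, labelPrefix (π (n + 1)) (h (n + 1)) ⊆ F := by
    filter_upwards [hsub, eventually_forall_lt_of_isPushLeft hpush hsub hfreq] with n hL hlt
    rw [(hpush n).labelPrefix_eq (hmax n)]
    intro a ha
    by_contra haF
    have hlast := hlt _ (hL (hmax n).1) a haF
    rw [Equiv.symm_apply_apply] at hlast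
    exact hlast.not_ge ha
  obtain ⟨N, hN⟩ := eventually_atTop.1 hev
  refine eventually_atTop.2 ⟨N + 1, fun n hn => ?_⟩
  obtain ⟨m, rfl⟩ := Nat.exists_eq_add_of_le' (Nat.one_le_of_lt hn)
  exact hN m (by omega)

theorem frequently_labelPrefix_eq [Finite Γ]
    (hpush : ∀ n, IsPushLeft (π n) (L n) (π (n + 1)))
    (hmax : ∀ n, IsMaxPos (π n) (L n) (h (n + 1))) (hF : F.Nonempty)
    (hsub : ∀ᶠ n in atTop, L n ⊆ F) (hfreq : ∀ a ∈ F, ∃ᶠ n in atTop, a ∈ L n) :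
    ∃ᶠ n in atTop, labelPrefix (π n) (h n) = F := by
  classical
  refine frequently_atTop.2 fun K => ?_
  obtain ⟨N, hN⟩ := eventually_atTop.1
    (hsub.and (eventually_forall_lt_of_isPushLeft hpush hsub hfreq))
  let M := max K N
  obtain ⟨x, hxF, hx⟩ := Set.exists_max_image F (π M).symm (Set.toFinite F) hF
  have hex : ∃ n, M ≤ n ∧ x ∈ L n := frequently_atTop.1 (hfreq x hxF) M
  obtain ⟨hMn, hxn⟩ := Nat.find_spec hex
  -- `x` remains the last element of `F` until it is pushed for the first time.
  have hlast : ∀ m, M ≤ m → m ≤ Nat.find hex → ∀ y ∈ F, (π m).symm y ≤ (π m).symm x := by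
    intro m hm
    induction m, hm using Nat.le_induction with
    | base => exact fun _ => hx
    | succ m hm ih =>
      intro hmn y hy
      have hxm : x ∉ L m := fun hxm => Nat.find_min hex hmn ⟨hm, hxm⟩
      rcases eq_or_ne y x with rfl | hne
      · exact le_rfl
      · exact ((hpush m).lt_of_lt hxm
          ((ih (by omega) y hy).lt_of_ne ((π m).symm.injective.ne hne))).le
  generalize Nat.find hex = n at *
  obtain ⟨hL, hlt⟩ := hN n ((le_max_right K N).trans hMn)
  have hpos : h (n + 1) = (π n).symm x := by
    refine le_antisymm ?_ ((hmax n).2 _ (by simpa using hxn))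
    simpa using hlast n hMn le_rfl _ (hL (hmax n).1)
  refine ⟨n + 1, by have := le_max_left K N; omega, ?_⟩
  rw [(hpush n).labelPrefix_eq (hmax n), hpos]
  refine Set.Subset.antisymm (fun a ha => ?_) fun a ha => hlast n hMn le_rfl a ha
  by_contra haF
  exact (hlt x hxF a haF).not_ge ha

end PushLeft

theorem exists_mem_infSet_of_frequently {S : Type*} [Finite S] {ϱ : ℕ → S} {p : S → Prop}
    (hp : ∃ᶠ n in atTop, p (ϱ n)) : ∃ s ∈ infSet ϱ, p s := by
  by_contra! hcon
  refine hp ?_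
  have hev : ∀ᶠ n in atTop, ∀ s, p s → ϱ n ≠ s := by
    simp only [eventually_all]
    exact fun s hs => not_frequently.1 fun hinf => hcon s hinf hs
  filter_upwards [hev] with n hn hpn
  exact hn _ hpn rfl

theorem eventually_mem_infSet {S : Type*} [Finite S] (ϱ : ℕ → S) :
    ∀ᶠ n in atTop, ϱ n ∈ infSet ϱ := by
  by_contra hcon
  obtain ⟨s, hs, hns⟩ := exists_mem_infSet_of_frequently (p := (· ∉ infSet ϱ))
    (not_eventually.1 hcon)
  exact hns hs

/-- If the sets `P s` of the recurring states `s` have a largest member `F`, and the color of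
`s` is determined by the size of `P s` and by whether `B` holds of it, then the parity condition
amounts to `B F`. -/
theorem satParity_iff_of_isGreatest {S Γ : Type*} [Finite Γ] {c : S → ℕ} {ϱ : ℕ → S}
    {B : Set Γ → Prop} {P : S → Set Γ} {F : Set Γ}
    (heven : ∀ s, B (P s) → c s = 2 * (P s).ncard)
    (hodd : ∀ s, ¬ B (P s) → c s + 1 = 2 * (P s).ncard)
    (hF : IsGreatest (P '' infSet ϱ) F) : B F ↔ SatParity c ϱ := by
  obtain ⟨⟨t, ht, rfl⟩, hle⟩ := hF
  have hcard : ∀ s ∈ infSet ϱ, (P s).ncard ≤ (P t).ncard := fun s hs =>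
    Set.ncard_le_ncard (hle ⟨s, hs, rfl⟩) (Set.toFinite _)
  constructor
  · intro hB
    refine ⟨c t, by simp [heven t hB], ⟨t, ht, rfl⟩, fun s hs => ?_⟩
    have := hcard s hs
    have := heven t hB
    by_cases hs' : B (P s)
    · have := heven s hs'; omega
    · have := hodd s hs'; omega
  · rintro ⟨_, ⟨r, hr⟩, ⟨s, hs, rfl⟩, hmax⟩
    by_contra hB
    have := hcard s hs
    have := hodd t hB
    have := hmax t ht
    by_cases hs' : B (P s)
    · have := heven s hs'
      refine hB ?_
      rwa [← Set.eq_of_subset_of_ncard_le (hle ⟨s, hs, rfl⟩) (by omega) (Set.toFinite _)]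
    · have := hodd s hs'; omega

theorem stmt_14 {Q A Γ : Type*} [Finite Q] [Fintype Γ] {k : ℕ}
    (hcard : Fintype.card Γ = k) (hk : 0 < k)
    (δ : Q → A → Q) (q₀ : Q)
    (lab : Q → Set Γ) (B : Set Γ → Prop) (hlab : ∀ q : Q, (lab q).Nonempty)
    (δ' : (Q × (Fin k ≃ Γ) × Fin k) → A → (Q × (Fin k ≃ Γ) × Fin k))
    (hδ' : ∀ (q : Q) (π : Fin k ≃ Γ) (h : Fin k) (a : A),
      (δ' (q, π, h) a).1 = δ q a ∧
      IsPushLeft π (lab q) (δ' (q, π, h) a).2.1 ∧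
      IsMaxPos π (lab q) (δ' (q, π, h) a).2.2)
    (π₀ : Fin k ≃ Γ)
    (c : (Q × (Fin k ≃ Γ) × Fin k) → ℕ)
    (hc : ∀ (q : Q) (π : Fin k ≃ Γ) (h : Fin k),
      (B {a : Γ | ((π.symm a : ℕ) ≤ (h : ℕ))} → c (q, π, h) = 2 * ((h : ℕ) + 1)) ∧
      (¬ B {a : Γ | ((π.symm a : ℕ) ≤ (h : ℕ))} → c (q, π, h) = 2 * (h : ℕ) + 1)) :
    (∀ w : ℕ → A,
      SatEL lab B (run δ q₀ w) ↔ SatParity c (run δ' (q₀, π₀, ⟨0, hk⟩) w)) ∧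
    (∀ s : Q × (Fin k ≃ Γ) × Fin k, 1 ≤ c s ∧ c s ≤ 2 * k) := by
  have heven : ∀ s, B (labelPrefix s.2.1 s.2.2) → c s = 2 * (labelPrefix s.2.1 s.2.2).ncard := by
    rintro ⟨q, π, h⟩ hB
    rw [ncard_labelPrefix]
    exact (hc q π h).1 hB
  have hodd : ∀ s, ¬ B (labelPrefix s.2.1 s.2.2) →
      c s + 1 = 2 * (labelPrefix s.2.1 s.2.2).ncard := by
    rintro ⟨q, π, h⟩ hB
    rw [ncard_labelPrefix, (hc q π h).2 hB]
    rfl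
  refine ⟨fun w => ?_, fun s => ?_⟩
  · set ϱ := run δ' (q₀, π₀, ⟨0, hk⟩) w
    have hfst : ∀ n, (ϱ n).1 = run δ q₀ w n := by
      intro n
      induction n with
      | zero => rfl
      | succ n ih =>
        rw [run, ← ih]
        exact (hδ' _ _ _ _).1
    let L : ℕ → Set Γ := fun n => lab (run δ q₀ w n)
    have hpush : ∀ n, IsPushLeft (ϱ n).2.1 (L n) (ϱ (n + 1)).2.1 := fun n => by
      simp only [L, ← hfst]
      exact (hδ' _ _ _ (w n)).2.1
    have hmax : ∀ n, IsMaxPos (ϱ n).2.1 (L n) (ϱ (n + 1)).2.2 := fun n => by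
      simp only [L, ← hfst]
      exact (hδ' _ _ _ (w n)).2.2
    have hsub : ∀ᶠ n in atTop, L n ⊆ ⋃ q ∈ infSet (run δ q₀ w), lab q := by
      filter_upwards [eventually_mem_infSet (run δ q₀ w)] with n hn
      exact Set.subset_biUnion_of_mem (u := lab) hn
    have hfreq : ∀ a ∈ ⋃ q ∈ infSet (run δ q₀ w), lab q, ∃ᶠ n in atTop, a ∈ L n := by
      intro a ha
      obtain ⟨q, hq, haq⟩ := Set.mem_iUnion₂.1 ha
      exact Frequently.mono hq fun n hn => by simpa only [L, hn] using haq
    have hne : (⋃ q ∈ infSet (run δ q₀ w), lab q).Nonempty := by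
      obtain ⟨n, hn⟩ := hsub.exists
      exact (hlab _).mono hn
    refine satParity_iff_of_isGreatest heven hodd ⟨?_, ?_⟩
    · exact exists_mem_infSet_of_frequently (frequently_labelPrefix_eq hpush hmax hne hsub hfreq)
    · rintro _ ⟨s, hs, rfl⟩
      obtain ⟨n, rfl, hn⟩ := (Frequently.and_eventually hs (eventually_labelPrefix_subset
        (h := fun n => (ϱ n).2.2) hpush hmax hsub hfreq)).exists
      exact hn
  · have hcard := ncard_labelPrefix s.2.1 s.2.2
    have := s.2.2.isLt
    by_cases hB : B (labelPrefix s.2.1 s.2.2)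
    · have := heven s hB; omega
    · have := hodd s hB; omega
end

section
/- Let Q be a finite type, Σ an alphabet, δ : Q → Σ → Q a deterministic transition function, q₀ : Q, and (lab, B) an EL condition over Q with label type Γ. Extend δ to finite words by δ*(q, []) = q and δ*(q, a :: u) = δ*(δ q a, u). Then there exists an infinite trace w : ℕ → Σ whose run from q₀ under δ satisfies the EL condition if and only if there exist a state s, a finite word u with δ*(q₀, u) = s, and a nonempty finite word v with δ*(s, v) = s such that B(L) holds, where L = ⋃_{0 ≤ i < |v|} lab(δ*(s, v.take i)) is the union of the label sets of the states visited along the v-cycle from s. -/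
/-- The extension `δ*` of a transition function `δ` to finite words. -/
def evalFrom {Q A : Type*} (δ : Q → A → Q) : Q → List A → Q
  | q, [] => q
  | q, a :: u => evalFrom δ (δ q a) u

theorem evalFrom_append {Q A : Type*} (δ : Q → A → Q) (q : Q) (u v : List A) :
    evalFrom δ q (u ++ v) = evalFrom δ (evalFrom δ q u) v := by
  induction u generalizing q with
  | nil => rfl
  | cons a u ih => exact ih (δ q a)

theorem evalFrom_take_succ {Q A : Type*} (δ : Q → A → Q) (q : Q) (u : List A) {i : ℕ}
    (hi : i < u.length) :
    evalFrom δ q (u.take (i + 1)) = δ (evalFrom δ q (u.take i)) u[i] := by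
  rw [← List.take_concat_get' u i hi, evalFrom_append]
  rfl

theorem evalFrom_map_range {Q A : Type*} (δ : Q → A → Q) (q₀ : Q) (w : ℕ → A) (n k : ℕ) :
    evalFrom δ (run δ q₀ w n) ((List.range k).map fun i => w (n + i)) =
      run δ q₀ w (n + k) := by
  induction k with
  | zero => rfl
  | succ k ih =>
    rw [List.range_succ, List.map_append, evalFrom_append, ih]
    rfl

/-- A sequence in a finite type contains a segment with equal endpoints that visits exactly
the states occurring infinitely often. -/
theorem exists_infSet_eq_image_Ico {Q : Type*} [Finite Q] (ρ : ℕ → Q) :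
    ∃ N m, N < m ∧ ρ m = ρ N ∧ infSet ρ = ρ '' Set.Ico N m := by
  have hev : ∀ᶠ n in Filter.atTop, ρ n ∈ infSet ρ := by
    have h : ∀ᶠ n in Filter.atTop, ∀ q, q ∉ infSet ρ → ρ n ≠ q := by
      refine Filter.eventually_all.2 fun q => ?_
      by_cases hq : q ∈ infSet ρ
      · exact Filter.Eventually.of_forall fun _ h => absurd hq h
      · exact (Filter.not_frequently.1 hq).mono fun _ h _ => h
    filter_upwards [h] with n hn
    by_contra hc
    exact hn _ hc rfl
  obtain ⟨N, hN⟩ := Filter.eventually_atTop.1 hev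
  have hvisit : ∀ q, ∃ n, q ∈ infSet ρ → N ≤ n ∧ ρ n = q := fun q => by
    by_cases hq : q ∈ infSet ρ
    · obtain ⟨n, hn, h⟩ := Filter.frequently_atTop.1 hq N
      exact ⟨n, fun _ => ⟨hn, h⟩⟩
    · exact ⟨0, fun h => absurd h hq⟩
  choose f hf using hvisit
  obtain ⟨M, hM⟩ := (Set.finite_range f).bddAbove
  obtain ⟨m, hm, hms⟩ := Filter.frequently_atTop.1 (hN N le_rfl) (max M N + 1)
  refine ⟨N, m, by omega, hms, Set.Subset.antisymm (fun q hq => ?_) ?_⟩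
  · have := hM (Set.mem_range_self q)
    exact ⟨f q, ⟨(hf q hq).1, by omega⟩, (hf q hq).2⟩
  · rintro _ ⟨n, hn, rfl⟩
    exact hN n hn.1

/-- A sequence that is eventually periodic with period `p`, reading off `c` along each period,
visits infinitely often exactly the values of `c` on `[0, p)`. -/
theorem infSet_eq_image_of_eventually_periodic {Q : Type*} {ρ c : ℕ → Q} {N p : ℕ}
    (hp : 0 < p) (h : ∀ k, ρ (N + k) = c (k % p)) : infSet ρ = c '' Set.Iio p := by
  ext q
  constructor
  · intro hq
    obtain ⟨n, hn, rfl⟩ := Filter.frequently_atTop.1 hq N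
    obtain ⟨k, rfl⟩ := Nat.exists_eq_add_of_le hn
    exact ⟨k % p, Nat.mod_lt _ hp, (h k).symm⟩
  · rintro ⟨i, hi, rfl⟩
    refine Filter.frequently_atTop.2 fun a => ⟨N + (i + p * a), ?_, ?_⟩
    · have := Nat.le_mul_of_pos_left a hp
      omega
    · rw [h, Nat.add_mul_mod_self_left, Nat.mod_eq_of_lt hi]

/-- A stem `u` followed by a cycle `v` is read by the run of some infinite trace. -/
theorem exists_run_lasso {Q A : Type*} (δ : Q → A → Q) (q₀ : Q) (u v : List A) (hv : v ≠ [])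
    (hcycle : evalFrom δ (evalFrom δ q₀ u) v = evalFrom δ q₀ u) :
    ∃ w : ℕ → A, ∀ k, run δ q₀ w (u.length + k) =
      evalFrom δ (evalFrom δ q₀ u) (v.take (k % v.length)) := by
  have hp : 0 < v.length := List.length_pos_iff.2 hv
  let w : ℕ → A := fun n =>
    if h : n < u.length then u[n]
    else v[(n - u.length) % v.length]'(Nat.mod_lt _ hp)
  have hstem : ∀ k ≤ u.length, run δ q₀ w k = evalFrom δ q₀ (u.take k) := by
    intro k
    induction k with
    | zero => intro _; rfl
    | succ k ih =>
      intro hk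
      rw [evalFrom_take_succ δ q₀ u hk, ← ih (by omega)]
      simp only [run, w, dif_pos (show k < u.length from hk)]
  refine ⟨w, fun k => ?_⟩
  induction k with
  | zero => simpa [evalFrom] using hstem u.length le_rfl
  | succ k ih =>
    have hk : k % v.length < v.length := Nat.mod_lt _ hp
    have hw : w (u.length + k) = v[k % v.length] := by simp [w]
    have hstep : run δ q₀ w (u.length + (k + 1)) =
        evalFrom δ (evalFrom δ q₀ u) (v.take (k % v.length + 1)) := by
      rw [evalFrom_take_succ δ _ v hk, ← ih, ← hw]
      rfl
    rw [hstep]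
    rcases Nat.lt_or_ge (k % v.length + 1) v.length with hlt | hge
    · rw [← Nat.mod_add_mod k, Nat.mod_eq_of_lt hlt]
    · have heq : k % v.length + 1 = v.length := by omega
      rw [← Nat.mod_add_mod k, heq, Nat.mod_self, List.take_length, hcycle]
      rfl

theorem stmt_15 {Q A Γ : Type*} [Finite Q]
    (δ : Q → A → Q) (q₀ : Q) (lab : Q → Set Γ) (B : Set Γ → Prop) :
    (∃ w : ℕ → A, SatEL lab B (run δ q₀ w)) ↔
      ∃ (s : Q) (u : List A), evalFrom δ q₀ u = s ∧
        ∃ v : List A, v ≠ [] ∧ evalFrom δ s v = s ∧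
          B (⋃ i ∈ {i : ℕ | i < v.length}, lab (evalFrom δ s (v.take i))) := by
  constructor
  · rintro ⟨w, hw⟩
    obtain ⟨N, m, hNm, hm, hinf⟩ := exists_infSet_eq_image_Ico (run δ q₀ w)
    obtain ⟨k, rfl⟩ := Nat.exists_eq_add_of_le hNm.le
    refine ⟨run δ q₀ w N, (List.range N).map w, ?_,
      (List.range k).map fun i => w (N + i), ?_, ?_, ?_⟩
    · simpa [run] using evalFrom_map_range δ q₀ w 0 N
    · intro h
      have := congrArg List.length h
      simp only [List.length_map, List.length_range, List.length_nil] at this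
      omega
    · rw [evalFrom_map_range, hm]
    · unfold SatEL at hw
      rw [hinf, Set.biUnion_image] at hw
      convert hw using 1
      ext x
      simp only [Set.mem_iUnion, Set.mem_ofPred_eq, List.length_map, List.length_range,
        Set.mem_Ico, exists_prop, ← List.map_take, List.take_range, evalFrom_map_range]
      constructor
      · rintro ⟨i, hi, hx⟩
        rw [min_eq_left hi.le] at hx
        exact ⟨N + i, by omega, hx⟩
      · rintro ⟨n, ⟨hn, hnk⟩, hx⟩
        obtain ⟨i, rfl⟩ := Nat.exists_eq_add_of_le hn
        refine ⟨i, by omega, ?_⟩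
        rwa [min_eq_left (by omega)]
  · rintro ⟨_, u, rfl, v, hv, hcycle, hB⟩
    obtain ⟨w, hw⟩ := exists_run_lasso δ q₀ u v hv hcycle
    refine ⟨w, ?_⟩
    unfold SatEL
    rw [infSet_eq_image_of_eventually_periodic
      (c := fun i => evalFrom δ (evalFrom δ q₀ u) (v.take i))
      (List.length_pos_iff.2 hv) hw, Set.biUnion_image]
    exact hB
end
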